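/- arXiv:1602.03990 — 3 statements merged into one kernel-verified Lean document; each statement's English description precedes it below -/
import Mathlib

section
/- Bottom-up correctness of the pyramid recursion (marginal likelihood of a subtree given its root state): for every node (j,k) ∈ T and every s ∈ {0,1}, φ_{j,k}(s) = Σ_{σ : T(j,k) → {0,1}, σ(j,k) = s} [ ∏_{(j',k') ∈ T(j,k) \ {(j,k)}} ρ_{j',k'}(σ(j'−1,⌊k'/2⌋), σ(j',k')) ] · [ ∏_{(j',k') ∈ T(j,k)} m_{j',k'}(σ(j',k')) ], where the sum ranges over all assignments of the subtree T(j,k) whose value at the root (j,k) is fixed to s. -/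
open scoped BigOperators

/-- If `m < 2^(t+1)` then `m / 2 < 2^t`. -/
lemma half_lt {t m : ℕ} (hm : m < 2 ^ (t + 1)) : m / 2 < 2 ^ t :=
  Nat.div_lt_of_lt_mul (by rw [mul_comm]; simpa [pow_succ] using hm)

/-- The bottom-up pyramid recursion `φ_{j,k}(s)`: at the bottom level `j = J` it equals the
node likelihood `m_{j,k}(s)`; above, `φ_{j,k}(s) = m_{j,k}(s) · ξ_{j+1,2k}(s) · ξ_{j+1,2k+1}(s)`
where `ξ_{j,k}(s) = ∑_{s'} ρ_{j,k}(s,s') φ_{j,k}(s')` for `j ≥ 1`. -/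
noncomputable def phi (J : ℕ) (ρ : ℕ → ℕ → Bool → Bool → ℝ)
    (m : ℕ → ℕ → Bool → ℝ) : ℕ → ℕ → Bool → ℝ
  | j, k, s =>
    if h : j < J then
      m j k s
        * (∑ s' : Bool, ρ (j + 1) (2 * k) s s' * phi J ρ m (j + 1) (2 * k) s')
        * (∑ s' : Bool, ρ (j + 1) (2 * k + 1) s s' * phi J ρ m (j + 1) (2 * k + 1) s')
    else m j k s
  termination_by j _ _ => J - j
  decreasing_by all_goals omega

/-- Assignments of states to the nodes of a full binary tree of depth `d`, listed by level. -/
abbrev Assignment (d : ℕ) : Type := (t : Fin (d + 1)) → Fin (2 ^ (t : ℕ)) → Bool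

namespace Assignment

variable {d : ℕ}

/-- The state at the root. -/
def root (σ : Assignment d) : Bool := σ ⟨0, by omega⟩ ⟨0, by positivity⟩

lemma left_lt {t m : ℕ} (hm : m < 2 ^ t) : m < 2 ^ (t + 1) := by
  rw [pow_succ]; omega

lemma right_lt {t m : ℕ} (hm : m < 2 ^ t) : 2 ^ t + m < 2 ^ (t + 1) := by
  rw [pow_succ]; omega

/-- The restriction to the subtree at the left child of the root. -/
def left (σ : Assignment (d + 1)) : Assignment d :=
  fun t m => σ ⟨(t : ℕ) + 1, by omega⟩ ⟨(m : ℕ), left_lt m.isLt⟩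

/-- The restriction to the subtree at the right child of the root. -/
def right (σ : Assignment (d + 1)) : Assignment d :=
  fun t m => σ ⟨(t : ℕ) + 1, by omega⟩ ⟨2 ^ (t : ℕ) + (m : ℕ), right_lt m.isLt⟩

/-- The assignment with a given state at the root and given restrictions to both subtrees. -/
def join (b : Bool) (σ τ : Assignment d) : Assignment (d + 1)
  | ⟨0, _⟩, _ => b
  | ⟨t + 1, ht⟩, m =>
    if h : (m : ℕ) < 2 ^ t then σ ⟨t, by omega⟩ ⟨m, h⟩
    else τ ⟨t, by omega⟩ ⟨(m : ℕ) - 2 ^ t, by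
      have := m.isLt
      simp only [pow_succ] at this
      simp only
      omega⟩

/-- An assignment is determined by its root state and its restrictions to both subtrees. -/
def splitEquiv (d : ℕ) : Assignment (d + 1) ≃ Bool × Assignment d × Assignment d where
  toFun σ := (σ.root, σ.left, σ.right)
  invFun p := join p.1 p.2.1 p.2.2
  left_inv σ := by
    funext t m
    obtain ⟨t, ht⟩ := t
    cases t with
    | zero =>
      have hm : m = ⟨0, by positivity⟩ := by
        ext
        have := m.isLt
        simp only [pow_zero] at this
        simp only
        omega
      subst hm
      rfl
    | succ t =>
      by_cases h : (m : ℕ) < 2 ^ t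
      · simp [join, left, h]
      · simp only [join, right, h, dite_false]
        congr 1
        ext
        simp only
        omega
  right_inv p := by
    obtain ⟨b, σ, τ⟩ := p
    refine Prod.ext rfl (Prod.ext ?_ ?_)
    · funext t m
      simp [left, join]
    · funext t m
      simp [right, join]

/-- The product of the transition weights along all edges, when the root is node `(j, k)`. -/
noncomputable def edgeWeight (ρ : ℕ → ℕ → Bool → Bool → ℝ) (j k : ℕ) (σ : Assignment d) : ℝ :=
  ∏ t : Fin d, ∏ m' : Fin (2 ^ ((t : ℕ) + 1)),
    ρ (j + (t : ℕ) + 1) (k * 2 ^ ((t : ℕ) + 1) + (m' : ℕ))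
      (σ ⟨(t : ℕ), by omega⟩ ⟨(m' : ℕ) / 2, half_lt m'.isLt⟩)
      (σ ⟨(t : ℕ) + 1, by omega⟩ m')

/-- The product of the node likelihoods, when the root is node `(j, k)`. -/
noncomputable def nodeWeight (m : ℕ → ℕ → Bool → ℝ) (j k : ℕ) (σ : Assignment d) : ℝ :=
  ∏ t : Fin (d + 1), ∏ m' : Fin (2 ^ (t : ℕ)),
    m (j + (t : ℕ)) (k * 2 ^ (t : ℕ) + (m' : ℕ)) (σ t m')

lemma prod_fin_two_pow_succ {M : Type*} [CommMonoid M] (t : ℕ) (f : Fin (2 ^ (t + 1)) → M) :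
    ∏ i, f i = (∏ i : Fin (2 ^ t), f ⟨(i : ℕ), left_lt i.isLt⟩) *
      ∏ i : Fin (2 ^ t), f ⟨2 ^ t + (i : ℕ), right_lt i.isLt⟩ := by
  have h : 2 ^ t + 2 ^ t = 2 ^ (t + 1) := by rw [pow_succ]; omega
  rw [← Equiv.prod_comp (finCongr h) f, Fin.prod_univ_add]
  rfl

lemma nodeWeight_succ (m : ℕ → ℕ → Bool → ℝ) (j k : ℕ) (σ : Assignment (d + 1)) :
    nodeWeight m j k σ = m j k σ.root *
      (nodeWeight m (j + 1) (2 * k) σ.left * nodeWeight m (j + 1) (2 * k + 1) σ.right) := by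
  unfold nodeWeight
  rw [Fin.prod_univ_succ, ← Finset.prod_mul_distrib]
  congr 1
  · simp only [Fin.val_zero, add_zero, pow_zero, mul_one]
    refine (Fin.prod_univ_one _).trans ?_
    simp [root]
  · refine Finset.prod_congr rfl fun t _ => ?_
    refine (prod_fin_two_pow_succ (t : ℕ) _).trans ?_
    congr 1 <;> refine Finset.prod_congr rfl fun i _ => ?_
    · exact congrArg₂ (fun a b => m a b (σ.left t i))
        (by simp only [Fin.val_succ]; ring) (by simp only [Fin.val_succ]; ring)
    · exact congrArg₂ (fun a b => m a b (σ.right t i))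
        (by simp only [Fin.val_succ]; ring) (by simp only [Fin.val_succ]; ring)

lemma edgeWeight_succ (ρ : ℕ → ℕ → Bool → Bool → ℝ) (j k : ℕ) (σ : Assignment (d + 1)) :
    edgeWeight ρ j k σ =
      (ρ (j + 1) (2 * k) σ.root σ.left.root * ρ (j + 1) (2 * k + 1) σ.root σ.right.root) *
      (edgeWeight ρ (j + 1) (2 * k) σ.left * edgeWeight ρ (j + 1) (2 * k + 1) σ.right) := by
  unfold edgeWeight
  rw [Fin.prod_univ_succ, ← Finset.prod_mul_distrib]
  congr 1
  · refine (prod_fin_two_pow_succ 0 _).trans ?_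
    simp [root, left, right, mul_comm k 2]
    rfl
  · refine Finset.prod_congr rfl fun t _ => ?_
    refine (prod_fin_two_pow_succ ((t : ℕ) + 1) _).trans ?_
    congr 1 <;> refine Finset.prod_congr rfl fun i _ => ?_
    · exact congrArg₂ (fun a b => ρ a b (σ.left ⟨t, by omega⟩ ⟨(i : ℕ) / 2, half_lt i.isLt⟩)
          (σ.left ⟨(t : ℕ) + 1, by omega⟩ i))
        (by simp only [Fin.val_succ]; ring) (by simp only [Fin.val_succ]; ring)
    · have hparent : (2 ^ ((t : ℕ) + 1) + (i : ℕ)) / 2 = 2 ^ (t : ℕ) + (i : ℕ) / 2 := by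
        have := pow_succ 2 (t : ℕ)
        omega
      have hσ : σ ⟨(t : ℕ) + 1, by omega⟩
          ⟨(2 ^ ((t : ℕ) + 1) + (i : ℕ)) / 2, half_lt (right_lt i.isLt)⟩ =
          σ.right ⟨t, by omega⟩ ⟨(i : ℕ) / 2, half_lt i.isLt⟩ :=
        congrArg (σ ⟨(t : ℕ) + 1, by omega⟩) (Fin.ext hparent)
      rw [← hσ]
      exact congrArg₂ (fun a b => ρ a b (σ ⟨(t : ℕ) + 1, by omega⟩
            ⟨(2 ^ ((t : ℕ) + 1) + (i : ℕ)) / 2, half_lt (right_lt i.isLt)⟩)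
          (σ.right ⟨(t : ℕ) + 1, by omega⟩ i))
        (by simp only [Fin.val_succ]; ring) (by simp only [Fin.val_succ]; ring)

end Assignment

open Assignment in
lemma phi_eq_sum_assignment (J : ℕ) (ρ : ℕ → ℕ → Bool → Bool → ℝ) (m : ℕ → ℕ → Bool → ℝ)
    (d j k : ℕ) (s : Bool) (hd : J - j = d) :
    phi J ρ m j k s = ∑ σ : Assignment d,
      if σ.root = s then edgeWeight ρ j k σ * nodeWeight m j k σ else 0 := by
  induction d generalizing j k s with
  | zero =>
    rw [phi, dif_neg (by omega)]
    let e : Assignment 0 ≃ Bool :=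
      { toFun := root
        invFun := fun b _ _ => b
        left_inv := fun σ => by
          funext t i
          obtain ⟨t, ht⟩ := t
          obtain rfl : t = 0 := by omega
          obtain ⟨i, hi⟩ := i
          obtain rfl : i = 0 := by simpa using hi
          rfl
        right_inv := fun _ => rfl }
    rw [← Equiv.sum_comp e.symm]
    have hroot (b : Bool) : root (e.symm b) = b := rfl
    have happly (b : Bool) (t) (i) : e.symm b t i = b := rfl
    simp [hroot, happly, edgeWeight, nodeWeight]
  | succ d ih =>
    have marginal (k' : ℕ) : ∑ s' : Bool, ρ (j + 1) k' s s' * phi J ρ m (j + 1) k' s' =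
        ∑ σ : Assignment d, ρ (j + 1) k' s σ.root *
          (edgeWeight ρ (j + 1) k' σ * nodeWeight m (j + 1) k' σ) := by
      simp_rw [ih (j + 1) k' _ (by omega), Finset.mul_sum]
      rw [Finset.sum_comm]
      simp
    rw [phi, dif_pos (by omega), marginal, marginal, mul_assoc, Finset.sum_mul_sum]
    let F (p : Bool × Assignment d × Assignment d) : ℝ :=
      if p.1 = s then m j k p.1 *
        ((ρ (j + 1) (2 * k) p.1 p.2.1.root *
          (edgeWeight ρ (j + 1) (2 * k) p.2.1 * nodeWeight m (j + 1) (2 * k) p.2.1)) *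
        (ρ (j + 1) (2 * k + 1) p.1 p.2.2.root *
          (edgeWeight ρ (j + 1) (2 * k + 1) p.2.2 * nodeWeight m (j + 1) (2 * k + 1) p.2.2)))
      else 0
    trans ∑ p, F p
    · simp_rw [Fintype.sum_prod_type, F, Finset.mul_sum]
      rw [Finset.sum_eq_single s (fun b _ hb => by simp [hb]) (by simp)]
      simp
    · rw [← Equiv.sum_comp (splitEquiv d)]
      refine Finset.sum_congr rfl fun σ _ => ?_
      rw [edgeWeight_succ, nodeWeight_succ]
      simp only [F, splitEquiv, Equiv.coe_fn_mk]
      congr 1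
      ring

/-- bottom-up correctness of the pyramid recursion. For every node `(j,k)` of the
full binary tree of depth `J` (i.e. `j ≤ J`, `k < 2^j`) and every state `s ∈ {0,1}`,
`φ_{j,k}(s)` equals the sum, over all assignments `σ` of the subtree `T(j,k)` whose value at the
root is `s`, of the product of the transition weights `ρ` along the edges of the subtree times
the product of the node likelihoods `m` over the subtree.  An assignment of the subtree is
encoded as `σ : (t : Fin (J - j + 1)) → Fin (2^t) → Bool`, where relative node `(t, m')`
corresponds to absolute node `(j + t, k·2^t + m')`, and the parent of relative node
`(t+1, m')` is `(t, ⌊m'/2⌋)`. -/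
theorem stmt0 (J : ℕ) (ρ₀ : Bool → ℝ) (ρ : ℕ → ℕ → Bool → Bool → ℝ)
    (m : ℕ → ℕ → Bool → ℝ) (j k : ℕ) (hj : j ≤ J) (hk : k < 2 ^ j) (s : Bool) :
    phi J ρ m j k s =
      ∑ σ : (t : Fin (J - j + 1)) → Fin (2 ^ (t : ℕ)) → Bool,
        if σ ⟨0, by omega⟩ ⟨0, by positivity⟩ = s then
          (∏ t : Fin (J - j), ∏ m' : Fin (2 ^ ((t : ℕ) + 1)),
              ρ (j + (t : ℕ) + 1) (k * 2 ^ ((t : ℕ) + 1) + (m' : ℕ))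
                (σ ⟨(t : ℕ), by have := t.isLt; omega⟩ ⟨(m' : ℕ) / 2, half_lt m'.isLt⟩)
                (σ ⟨(t : ℕ) + 1, by have := t.isLt; omega⟩ m'))
            * (∏ t : Fin (J - j + 1), ∏ m' : Fin (2 ^ (t : ℕ)),
                m (j + (t : ℕ)) (k * 2 ^ (t : ℕ) + (m' : ℕ)) (σ t m'))
        else 0 := by
  exact phi_eq_sum_assignment J ρ m (J - j) j k s rfl
end

section
/- Interpretation of ξ as the conditional marginal likelihood of a subtree given the parent state: for every node (j,k) ∈ T with j ≥ 1 and every s ∈ {0,1}, ξ_{j,k}(s) = Σ_{σ : T(j,k) → {0,1}} ρ_{j,k}(s, σ(j,k)) · [ ∏_{(j',k') ∈ T(j,k) \ {(j,k)}} ρ_{j',k'}(σ(j'−1,⌊k'/2⌋), σ(j',k')) ] · [ ∏_{(j',k') ∈ T(j,k)} m_{j',k'}(σ(j',k')) ], where the sum ranges over all assignments of the subtree T(j,k). -/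
open scoped BigOperators

/-- `ξ_{j,k}(s) = ∑_{s'} ρ_{j,k}(s,s') · φ_{j,k}(s')`, for `j ≥ 1`. -/
noncomputable def xi (J : ℕ) (ρ : ℕ → ℕ → Bool → Bool → ℝ)
    (m : ℕ → ℕ → Bool → ℝ) (j k : ℕ) (s : Bool) : ℝ :=
  ∑ s' : Bool, ρ j k s s' * phi J ρ m j k s'

/-- A `{0,1}`-labelling of the full binary tree of depth `n`, level by level. -/
abbrev Labelling (n : ℕ) : Type := (t : Fin (n + 1)) → Fin (2 ^ (t : ℕ)) → Bool

namespace Labelling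

variable {n : ℕ}

/-- The label of the root. -/
def root (σ : Labelling n) : Bool := σ ⟨0, n.succ_pos⟩ ⟨0, by positivity⟩

lemma apply_zero (σ : Labelling n) (i : Fin (2 ^ ((0 : Fin (n + 1)) : ℕ))) : σ 0 i = σ.root :=
  congrArg (σ 0) (Fin.ext (Nat.lt_one_iff.mp i.isLt))

/-- The labelling of the subtree rooted at the left child. -/
def left (σ : Labelling (n + 1)) : Labelling n := fun t i =>
  σ t.succ ⟨i, i.isLt.trans (Nat.pow_lt_pow_right one_lt_two (Nat.lt_succ_self _))⟩

/-- The labelling of the subtree rooted at the right child. -/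
def right (σ : Labelling (n + 1)) : Labelling n := fun t i =>
  σ t.succ ⟨2 ^ (t : ℕ) + i, by
    have := i.isLt
    rw [Fin.val_succ, pow_succ]
    omega⟩

/-- The labelling with given root label and given restrictions to the two child subtrees. -/
def join (b : Bool) (τ₁ τ₂ : Labelling n) : Labelling (n + 1) :=
  Fin.cases (fun _ => b) fun t i =>
    if h : (i : ℕ) < 2 ^ (t : ℕ) then τ₁ t ⟨i, h⟩
    else τ₂ t ⟨i - 2 ^ (t : ℕ), by
      have := i.isLt.trans_eq (pow_succ 2 (t : ℕ))
      omega⟩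

/-- A labelling of a tree of positive depth amounts to a root label and labellings of the two
child subtrees. -/
def equivProd (n : ℕ) : Labelling (n + 1) ≃ Bool × Labelling n × Labelling n where
  toFun σ := (σ.root, σ.left, σ.right)
  invFun p := join p.1 p.2.1 p.2.2
  left_inv σ := by
    funext t
    refine Fin.cases ?_ (fun t => ?_) t
    · funext i
      exact (σ.apply_zero i).symm
    · funext i
      simp only [join, Fin.cases_succ]
      split_ifs with h
      · rfl
      · exact congrArg (σ t.succ) (Fin.ext (Nat.add_sub_cancel' (not_lt.mp h)))
  right_inv := by
    rintro ⟨b, τ₁, τ₂⟩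
    refine Prod.ext rfl (Prod.ext ?_ ?_)
    · funext t i
      exact dif_pos i.isLt
    · funext t i
      exact (dif_neg (Nat.not_lt.mpr (Nat.le_add_right _ _))).trans
        (congrArg (τ₂ t) (Fin.ext (Nat.add_sub_cancel_left (2 ^ (t : ℕ)) i)))

/-- A labelling of a one-node tree amounts to a root label. -/
def equivBool : Labelling 0 ≃ Bool where
  toFun σ := σ.root
  invFun b := fun _ _ => b
  left_inv σ := by
    funext t i
    obtain ⟨t, ht⟩ := t
    obtain rfl : t = 0 := by omega
    exact (σ.apply_zero i).symm
  right_inv _ := rfl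

/-- The product of the transition weights along the edges of the subtree rooted at `(j, k)`. -/
def edgeWeight (ρ : ℕ → ℕ → Bool → Bool → ℝ) (j k : ℕ) (σ : Labelling n) : ℝ :=
  ∏ t : Fin n, ∏ i : Fin (2 ^ ((t : ℕ) + 1)),
    ρ (j + (t : ℕ) + 1) (k * 2 ^ ((t : ℕ) + 1) + (i : ℕ))
      (σ ⟨(t : ℕ), by have := t.isLt; omega⟩ ⟨(i : ℕ) / 2, half_lt i.isLt⟩)
      (σ ⟨(t : ℕ) + 1, by have := t.isLt; omega⟩ i)

/-- The product of the node likelihoods over the subtree rooted at `(j, k)`. -/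
def nodeWeight (m : ℕ → ℕ → Bool → ℝ) (j k : ℕ) (σ : Labelling n) : ℝ :=
  ∏ t : Fin (n + 1), ∏ i : Fin (2 ^ (t : ℕ)),
    m (j + (t : ℕ)) (k * 2 ^ (t : ℕ) + (i : ℕ)) (σ t i)

end Labelling

lemma prod_fin_two_pow_succ {M : Type*} [CommMonoid M] (t : ℕ) (f : Fin (2 ^ (t + 1)) → M) :
    ∏ i, f i =
      (∏ i : Fin (2 ^ t), f ⟨i, by have := i.isLt; rw [pow_succ]; omega⟩) *
        ∏ i : Fin (2 ^ t), f ⟨2 ^ t + i, by have := i.isLt; rw [pow_succ]; omega⟩ := by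
  rw [← Equiv.prod_comp (finCongr (show 2 ^ t + 2 ^ t = 2 ^ (t + 1) by rw [pow_succ]; omega)) f,
    Fin.prod_univ_add]
  rfl

namespace Labelling

variable {n : ℕ}

lemma nodeWeight_succ (m : ℕ → ℕ → Bool → ℝ) (j k : ℕ) (σ : Labelling (n + 1)) :
    nodeWeight m j k σ =
      m j k σ.root *
        (nodeWeight m (j + 1) (2 * k) σ.left * nodeWeight m (j + 1) (2 * k + 1) σ.right) := by
  unfold nodeWeight
  rw [Fin.prod_univ_succ, ← Finset.prod_mul_distrib]
  congr 1
  · refine (Fin.prod_univ_one _).trans ?_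
    exact congrArg (fun b => m j b _) (by simp)
  · refine Finset.prod_congr rfl fun t _ => ?_
    refine (prod_fin_two_pow_succ (t : ℕ) _).trans ?_
    congr 1 <;> refine Finset.prod_congr rfl fun i _ => ?_
    · exact congrArg₂ (fun a b => m a b _) (by simp; ring) (by simp; ring)
    · exact congrArg₂ (fun a b => m a b _) (by simp; ring) (by simp; ring)

lemma edgeWeight_succ (ρ : ℕ → ℕ → Bool → Bool → ℝ) (j k : ℕ) (σ : Labelling (n + 1)) :
    edgeWeight ρ j k σ =
      (ρ (j + 1) (2 * k) σ.root σ.left.root * edgeWeight ρ (j + 1) (2 * k) σ.left) *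
        (ρ (j + 1) (2 * k + 1) σ.root σ.right.root *
          edgeWeight ρ (j + 1) (2 * k + 1) σ.right) := by
  unfold edgeWeight
  rw [mul_mul_mul_comm, Fin.prod_univ_succ, ← Finset.prod_mul_distrib]
  congr 1
  · refine (prod_fin_two_pow_succ 0 _).trans ?_
    congr 1
    · refine (Fin.prod_univ_one _).trans ?_
      exact congrArg₂ (fun a b => ρ (j + 1) a b σ.left.root) (by simp [mul_comm]) (σ.apply_zero _)
    · refine (Fin.prod_univ_one _).trans ?_
      exact congrArg₂ (fun a b => ρ (j + 1) a b σ.right.root) (by simp [mul_comm]) (σ.apply_zero _)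
  · refine Finset.prod_congr rfl fun t _ => ?_
    refine (prod_fin_two_pow_succ ((t : ℕ) + 1) _).trans ?_
    congr 1 <;> refine Finset.prod_congr rfl fun i _ => ?_
    · exact congrArg₂ (fun a b => ρ a b _ _) (by simp; ring) (by simp; ring)
    · have h : (⟨(2 ^ ((t : ℕ) + 1) + (i : ℕ)) / 2, half_lt (by
          have := i.isLt; rw [pow_succ _ ((t : ℕ) + 1)]; omega)⟩ : Fin (2 ^ ((t : ℕ) + 1))) =
          ⟨2 ^ (t : ℕ) + (i : ℕ) / 2, by
            have := i.isLt.trans_eq (pow_succ 2 (t : ℕ))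
            exact lt_of_lt_of_eq (by omega) (pow_succ 2 (t : ℕ)).symm⟩ :=
        Fin.ext (by simp only [pow_succ]; omega)
      have h' := congrArg (σ t.castSucc.succ) h
      refine (congrArg (fun c => ρ _ _ c _) h').trans ?_
      exact congrArg₂ (fun a b => ρ a b _ _) (by simp; ring) (by simp; ring)

end Labelling

open Labelling in
/-- `ξ` as a sum over labellings of the subtree of depth `n = J - j` rooted at `(j, k)`. -/
lemma xi_eq_sum_labelling (J : ℕ) (ρ : ℕ → ℕ → Bool → Bool → ℝ) (m : ℕ → ℕ → Bool → ℝ) (n : ℕ) :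
    ∀ (j k : ℕ) (s : Bool), J = j + n →
      xi J ρ m j k s =
        ∑ σ : Labelling n, ρ j k s σ.root * edgeWeight ρ j k σ * nodeWeight m j k σ := by
  induction n with
  | zero =>
    intro j k s hJ
    rw [← equivBool.symm.sum_comp]
    refine Finset.sum_congr rfl fun b _ => ?_
    rw [phi, dif_neg (by omega)]
    simp [edgeWeight, nodeWeight, root, equivBool]
  | succ n ih =>
    intro j k s hJ
    rw [← (equivProd n).symm.sum_comp, Fintype.sum_prod_type]
    unfold xi
    refine Finset.sum_congr rfl fun b _ => ?_
    rw [phi, dif_pos (by omega)]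
    change ρ j k s b * (m j k b * xi J ρ m (j + 1) (2 * k) b *
      xi J ρ m (j + 1) (2 * k + 1) b) = _
    rw [ih (j + 1) (2 * k) b (by omega), ih (j + 1) (2 * k + 1) b (by omega), mul_assoc (m j k b),
      Fintype.sum_mul_sum, Fintype.sum_prod_type, Finset.mul_sum, Finset.mul_sum]
    refine Finset.sum_congr rfl fun τ₁ _ => ?_
    rw [Finset.mul_sum, Finset.mul_sum]
    refine Finset.sum_congr rfl fun τ₂ _ => ?_
    have h := (equivProd n).apply_symm_apply (b, τ₁, τ₂)
    obtain ⟨h₁, h₂, h₃⟩ : ((equivProd n).symm (b, τ₁, τ₂)).root = b ∧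
        ((equivProd n).symm (b, τ₁, τ₂)).left = τ₁ ∧
        ((equivProd n).symm (b, τ₁, τ₂)).right = τ₂ := by
      simpa [equivProd] using h
    rw [edgeWeight_succ, nodeWeight_succ, h₁, h₂, h₃]
    ring

/-- interpretation of `ξ` as the conditional marginal likelihood of a subtree given
the parent state.  For every node `(j,k)` with `1 ≤ j ≤ J`, `k < 2^j`, and every `s ∈ {0,1}`,
`ξ_{j,k}(s)` is the sum over all assignments `σ` of the subtree `T(j,k)` of
`ρ_{j,k}(s, σ(root))` times the product of the transition weights along the edges of the subtree
times the product of node likelihoods over the subtree. -/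
theorem stmt1 (J : ℕ) (ρ₀ : Bool → ℝ) (ρ : ℕ → ℕ → Bool → Bool → ℝ)
    (m : ℕ → ℕ → Bool → ℝ) (j k : ℕ) (hj1 : 1 ≤ j) (hjJ : j ≤ J) (hk : k < 2 ^ j)
    (s : Bool) :
    xi J ρ m j k s =
      ∑ σ : (t : Fin (J - j + 1)) → Fin (2 ^ (t : ℕ)) → Bool,
        ρ j k s (σ ⟨0, by omega⟩ ⟨0, by positivity⟩)
          * (∏ t : Fin (J - j), ∏ m' : Fin (2 ^ ((t : ℕ) + 1)),
              ρ (j + (t : ℕ) + 1) (k * 2 ^ ((t : ℕ) + 1) + (m' : ℕ))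
                (σ ⟨(t : ℕ), by have := t.isLt; omega⟩ ⟨(m' : ℕ) / 2, half_lt m'.isLt⟩)
                (σ ⟨(t : ℕ) + 1, by have := t.isLt; omega⟩ m'))
          * (∏ t : Fin (J - j + 1), ∏ m' : Fin (2 ^ (t : ℕ)),
              m (j + (t : ℕ)) (k * 2 ^ (t : ℕ) + (m' : ℕ)) (σ t m')) := by
  exact xi_eq_sum_labelling J ρ m (J - j) j k s (by omega)
end

section
/- Theorem S1 (hidden-state part, multi-way fANOVA with L factors): the posterior of the hidden states (S, R₁, …, R_L) is a Markov tree on the product state space {0,1}^{L+1}. Precisely, assume ξ_{j,k}(s,r) ≠ 0 for all (j,k) ∈ T with j ≥ 1 and all (s,r) ∈ {0,1}×{0,1}^L, and ξ₀₀(0,0) ≠ 0. Then for every assignment (S, R₁,…,R_L) : T → {0,1}^{L+1}: [ρ₀₀(S(0,0))·∏_{l=1}^{L}κ₀₀(R_l(0,0))·φ₀₀(S(0,0),R(0,0))/ξ₀₀(0,0)] · ∏_{j=1}^{J} ∏_{k} [ρ_{j,k}(S_p, S(j,k))·∏_{l=1}^{L}κ_{j,k}(R_{l,p}, R_l(j,k))·φ_{j,k}(S(j,k),R(j,k))/ξ_{j,k}(S_p,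 R_p)] = P·L̃/ξ₀₀(0,0), where the subscript p denotes the value at the parent node (j−1,⌊k/2⌋), P = ρ₀₀(S(0,0))∏_l κ₀₀(R_l(0,0)) · ∏_{j=1}^{J}∏_k ρ_{j,k}(S_p,S(j,k))∏_l κ_{j,k}(R_{l,p},R_l(j,k)) is the prior weight, and L̃ = ∏_{(j,k)∈T} m_{j,k}(S(j,k), R₁(j,k),…,R_L(j,k)) is the likelihood weight. -/
open scoped BigOperators

/-- The bottom-up pyramid recursion `φ_{j,k}(s,r)` for the hidden states
`(S, R₁, …, R_L) ∈ {0,1}^{L+1}` of the multi-way fANOVA model: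
`φ_{J,k}(s,r) = m_{J,k}(s,r)`, and for `j < J`,
`φ_{j,k}(s,r) = m_{j,k}(s,r)·ξ_{j+1,2k}(s,r)·ξ_{j+1,2k+1}(s,r)` where
`ξ_{j,k}(s,r) = ∑_{s',r'} ρ_{j,k}(s,s')·∏_l κ_{j,k}(r_l,r'_l)·φ_{j,k}(s',r')`. -/
noncomputable def phiL (J L : ℕ) (ρ κ : ℕ → ℕ → Bool → Bool → ℝ)
    (m : ℕ → ℕ → Bool → (Fin L → Bool) → ℝ) : ℕ → ℕ → Bool → (Fin L → Bool) → ℝ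
  | j, k, s, r =>
    if h : j < J then
      m j k s r
        * (∑ s' : Bool, ∑ r' : Fin L → Bool,
            ρ (j + 1) (2 * k) s s' * (∏ l : Fin L, κ (j + 1) (2 * k) (r l) (r' l))
              * phiL J L ρ κ m (j + 1) (2 * k) s' r')
        * (∑ s' : Bool, ∑ r' : Fin L → Bool,
            ρ (j + 1) (2 * k + 1) s s' * (∏ l : Fin L, κ (j + 1) (2 * k + 1) (r l) (r' l))
              * phiL J L ρ κ m (j + 1) (2 * k + 1) s' r')
    else m j k s r
  termination_by j _ _ _ => J - j
  decreasing_by all_goals omega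

/-- `ξ_{j,k}(s,r) = ∑_{s',r'} ρ_{j,k}(s,s')·∏_l κ_{j,k}(r_l,r'_l)·φ_{j,k}(s',r')`, for `j ≥ 1`. -/
noncomputable def xiL (J L : ℕ) (ρ κ : ℕ → ℕ → Bool → Bool → ℝ)
    (m : ℕ → ℕ → Bool → (Fin L → Bool) → ℝ) (j k : ℕ) (s : Bool) (r : Fin L → Bool) : ℝ :=
  ∑ s' : Bool, ∑ r' : Fin L → Bool,
    ρ j k s s' * (∏ l : Fin L, κ j k (r l) (r' l)) * phiL J L ρ κ m j k s' r'

/-- `ξ₀₀(0,0) = ∑_{s',r'} ρ₀₀(s')·∏_l κ₀₀(r'_l)·φ₀₀(s',r')` (independent of its arguments). -/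
noncomputable def xiRootL (J L : ℕ) (ρ₀ κ₀ : Bool → ℝ) (ρ κ : ℕ → ℕ → Bool → Bool → ℝ)
    (m : ℕ → ℕ → Bool → (Fin L → Bool) → ℝ) : ℝ :=
  ∑ s' : Bool, ∑ r' : Fin L → Bool,
    ρ₀ s' * (∏ l : Fin L, κ₀ (r' l)) * phiL J L ρ κ m 0 0 s' r'

/-- A product over `Fin (n * 2)` groups into the pairs `2 * k`, `2 * k + 1`. -/
lemma prod_fin_div_two {n N : ℕ} (hN : N = n * 2) (g : ℕ → Fin n → ℝ)
    (hlt : ∀ i : Fin N, (i : ℕ) / 2 < n) :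
    ∏ i : Fin N, g i ⟨(i : ℕ) / 2, hlt i⟩ = ∏ k : Fin n, g (2 * k) k * g (2 * k + 1) k := by
  subst hN
  rw [← finProdFinEquiv.prod_comp, Fintype.prod_prod_type]
  refine Finset.prod_congr rfl fun k _ => ?_
  rw [Fin.prod_univ_two]
  congr 2 <;> simp [finProdFinEquiv] <;> grind

/-- Telescoping: if `A t = M t * X t` for `t < J` and `A J = M J`, then
`A 0 * ∏ t, A (t + 1) / X t = ∏ t, M t`. -/
lemma mul_prod_succ_div {J : ℕ} (A M : Fin (J + 1) → ℝ) (X : Fin J → ℝ)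
    (hA : ∀ t : Fin J, A t.castSucc = M t.castSucc * X t)
    (hlast : A (Fin.last J) = M (Fin.last J)) (hX : ∀ t, X t ≠ 0) :
    A 0 * ∏ t : Fin J, A t.succ / X t = ∏ t, M t := by
  rw [Finset.prod_div_distrib, ← mul_div_assoc, ← Fin.prod_univ_succ A,
    div_eq_iff (Finset.prod_ne_zero_iff.2 fun t _ => hX t), Fin.prod_univ_castSucc A,
    Fin.prod_univ_castSucc M, hlast, Finset.prod_congr rfl fun t _ => hA t,
    Finset.prod_mul_distrib]
  ring

lemma phiL_of_lt {J L : ℕ} (ρ κ : ℕ → ℕ → Bool → Bool → ℝ)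
    (m : ℕ → ℕ → Bool → (Fin L → Bool) → ℝ) {j : ℕ} (hj : j < J) (k : ℕ) (s : Bool)
    (r : Fin L → Bool) :
    phiL J L ρ κ m j k s r = m j k s r *
      (xiL J L ρ κ m (j + 1) (2 * k) s r * xiL J L ρ κ m (j + 1) (2 * k + 1) s r) := by
  rw [phiL, dif_pos hj, mul_assoc]
  rfl

lemma phiL_self {J L : ℕ} (ρ κ : ℕ → ℕ → Bool → Bool → ℝ)
    (m : ℕ → ℕ → Bool → (Fin L → Bool) → ℝ) (k : ℕ) (s : Bool) (r : Fin L → Bool) :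
    phiL J L ρ κ m J k s r = m J k s r := by
  rw [phiL, dif_neg (lt_irrefl J)]

/-- On a full binary tree labelled by hidden states, the root `φ` times the product of the ratios
`φ / ξ` over the non-root nodes is the likelihood weight. -/
lemma phiL_mul_prod_div_xiL {J L : ℕ} (ρ κ : ℕ → ℕ → Bool → Bool → ℝ)
    (m : ℕ → ℕ → Bool → (Fin L → Bool) → ℝ)
    (hξ : ∀ j k, 1 ≤ j → j ≤ J → k < 2 ^ j →
      ∀ (s : Bool) (r : Fin L → Bool), xiL J L ρ κ m j k s r ≠ 0)
    (S : (t : Fin (J + 1)) → Fin (2 ^ (t : ℕ)) → Bool)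
    (R : Fin L → (t : Fin (J + 1)) → Fin (2 ^ (t : ℕ)) → Bool) :
    phiL J L ρ κ m 0 0 (S ⟨0, by omega⟩ ⟨0, by positivity⟩)
        (fun l => R l ⟨0, by omega⟩ ⟨0, by positivity⟩)
      * ∏ t : Fin J,
          (∏ k : Fin (2 ^ ((t : ℕ) + 1)),
            phiL J L ρ κ m ((t : ℕ) + 1) k (S t.succ k) (fun l => R l t.succ k))
          / ∏ k : Fin (2 ^ ((t : ℕ) + 1)),
            xiL J L ρ κ m ((t : ℕ) + 1) k (S t.castSucc ⟨(k : ℕ) / 2, half_lt k.isLt⟩)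
              (fun l => R l t.castSucc ⟨(k : ℕ) / 2, half_lt k.isLt⟩)
    = ∏ t : Fin (J + 1), ∏ k : Fin (2 ^ (t : ℕ)), m t k (S t k) (fun l => R l t k) := by
  rw [← mul_prod_succ_div
    (fun t : Fin (J + 1) => ∏ k : Fin (2 ^ (t : ℕ)),
      phiL J L ρ κ m t k (S t k) (fun l => R l t k))
    (fun t : Fin (J + 1) => ∏ k : Fin (2 ^ (t : ℕ)), m t k (S t k) (fun l => R l t k))
    (fun t : Fin J => ∏ k : Fin (2 ^ ((t : ℕ) + 1)),
      xiL J L ρ κ m ((t : ℕ) + 1) k (S t.castSucc ⟨(k : ℕ) / 2, half_lt k.isLt⟩)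
        (fun l => R l t.castSucc ⟨(k : ℕ) / 2, half_lt k.isLt⟩))]
  · congr 1
    exact (Fin.prod_univ_one fun k : Fin 1 =>
      phiL J L ρ κ m 0 k (S 0 k) (fun l => R l 0 k)).symm
  · intro t
    rw [prod_fin_div_two (pow_succ 2 (t : ℕ)) (fun i k =>
      xiL J L ρ κ m ((t : ℕ) + 1) i (S t.castSucc k) (fun l => R l t.castSucc k))]
    refine Eq.trans ?_ Finset.prod_mul_distrib
    exact Finset.prod_congr rfl fun k _ => phiL_of_lt ρ κ m t.isLt _ _ _
  · exact Finset.prod_congr rfl fun k _ => phiL_self ρ κ m _ _ _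
  · exact fun t => Finset.prod_ne_zero_iff.2 fun k _ =>
      hξ _ _ (by omega) (by omega) k.isLt _ _

/-- Theorem S1, hidden-state part, multi-way fANOVA with `L` factors: the
posterior of the hidden states `(S, R₁, …, R_L)` is a Markov tree on the product state space
`{0,1}^{L+1}`: assuming all `ξ_{j,k}(s,r) ≠ 0` (for `j ≥ 1`) and `ξ₀₀(0,0) ≠ 0`, for every
assignment `(S, R₁, …, R_L)` of the full tree the product of posterior initial and transition
probabilities equals the prior weight times the likelihood weight divided by `ξ₀₀(0,0)`. -/
theorem stmt5 (J L : ℕ) (hL : 1 ≤ L) (ρ₀ κ₀ : Bool → ℝ) (ρ κ : ℕ → ℕ → Bool → Bool → ℝ)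
    (m : ℕ → ℕ → Bool → (Fin L → Bool) → ℝ)
    (hξ : ∀ j k, 1 ≤ j → j ≤ J → k < 2 ^ j →
      ∀ (s : Bool) (r : Fin L → Bool), xiL J L ρ κ m j k s r ≠ 0)
    (hξ0 : xiRootL J L ρ₀ κ₀ ρ κ m ≠ 0)
    (S : (t : Fin (J + 1)) → Fin (2 ^ (t : ℕ)) → Bool)
    (R : Fin L → (t : Fin (J + 1)) → Fin (2 ^ (t : ℕ)) → Bool) :
    (ρ₀ (S ⟨0, by omega⟩ ⟨0, by positivity⟩)
          * (∏ l : Fin L, κ₀ (R l ⟨0, by omega⟩ ⟨0, by positivity⟩))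
          * phiL J L ρ κ m 0 0 (S ⟨0, by omega⟩ ⟨0, by positivity⟩)
              (fun l => R l ⟨0, by omega⟩ ⟨0, by positivity⟩)
          / xiRootL J L ρ₀ κ₀ ρ κ m)
        * ∏ t : Fin J, ∏ kk : Fin (2 ^ ((t : ℕ) + 1)),
            (ρ ((t : ℕ) + 1) (kk : ℕ)
                (S ⟨(t : ℕ), by have := t.isLt; omega⟩ ⟨(kk : ℕ) / 2, half_lt kk.isLt⟩)
                (S ⟨(t : ℕ) + 1, by have := t.isLt; omega⟩ kk)
              * (∏ l : Fin L, κ ((t : ℕ) + 1) (kk : ℕ)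
                  (R l ⟨(t : ℕ), by have := t.isLt; omega⟩ ⟨(kk : ℕ) / 2, half_lt kk.isLt⟩)
                  (R l ⟨(t : ℕ) + 1, by have := t.isLt; omega⟩ kk))
              * phiL J L ρ κ m ((t : ℕ) + 1) (kk : ℕ)
                  (S ⟨(t : ℕ) + 1, by have := t.isLt; omega⟩ kk)
                  (fun l => R l ⟨(t : ℕ) + 1, by have := t.isLt; omega⟩ kk)
              / xiL J L ρ κ m ((t : ℕ) + 1) (kk : ℕ)
                  (S ⟨(t : ℕ), by have := t.isLt; omega⟩ ⟨(kk : ℕ) / 2, half_lt kk.isLt⟩)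
                  (fun l => R l ⟨(t : ℕ), by have := t.isLt; omega⟩
                    ⟨(kk : ℕ) / 2, half_lt kk.isLt⟩))
    = (ρ₀ (S ⟨0, by omega⟩ ⟨0, by positivity⟩)
          * (∏ l : Fin L, κ₀ (R l ⟨0, by omega⟩ ⟨0, by positivity⟩))
          * ∏ t : Fin J, ∏ kk : Fin (2 ^ ((t : ℕ) + 1)),
              ρ ((t : ℕ) + 1) (kk : ℕ)
                  (S ⟨(t : ℕ), by have := t.isLt; omega⟩ ⟨(kk : ℕ) / 2, half_lt kk.isLt⟩)
                  (S ⟨(t : ℕ) + 1, by have := t.isLt; omega⟩ kk)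
                * ∏ l : Fin L, κ ((t : ℕ) + 1) (kk : ℕ)
                    (R l ⟨(t : ℕ), by have := t.isLt; omega⟩ ⟨(kk : ℕ) / 2, half_lt kk.isLt⟩)
                    (R l ⟨(t : ℕ) + 1, by have := t.isLt; omega⟩ kk))
        * (∏ t : Fin (J + 1), ∏ kk : Fin (2 ^ (t : ℕ)),
            m (t : ℕ) (kk : ℕ) (S t kk) (fun l => R l t kk))
        / xiRootL J L ρ₀ κ₀ ρ κ m := by
  rw [← phiL_mul_prod_div_xiL ρ κ m hξ S R]
  simp only [mul_div_assoc, Finset.prod_mul_distrib, Finset.prod_div_distrib]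
  simp only [Fin.succ, Fin.castSucc, Fin.castAdd, Fin.castLE]
  ring
end
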